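/- arXiv:1010.5838 — 2 statements merged into one kernel-verified Lean document; each statement's English description precedes it below -/
import Mathlib

section
/- Let U be an n×n unitary complex matrix. For A ⊆ {1,…,n} define s(A) = { j ∈ {1,…,n} : ∃ i ∈ A, U_{ij} ≠ 0 } and s*(A) = { j ∈ {1,…,n} : ∃ i ∈ A, U_{ji} ≠ 0 }. Then there exists a partition {σ_1,…,σ_p} of {1,…,n} such that, setting ψ_i := s(σ_i) for each i: the sets {ψ_1,…,ψ_p} also form a partition of {1,…,n}; s*(ψ_i) = σ_i for each i; |σ_i| = |ψ_i| for each i; and moreover every subset A ⊆ {1,…,n} satisfying s*(s(A)) = A equals the union of those σ_i that are contained in A. -/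
open scoped Classical in
/-- The support function of a matrix: `supp U A = { j : ∃ i ∈ A, U i j ≠ 0 }`. -/
noncomputable def supp {n : ℕ} (U : Matrix (Fin n) (Fin n) ℂ) (A : Finset (Fin n)) :
    Finset (Fin n) :=
  Finset.univ.filter (fun j => ∃ i ∈ A, U i j ≠ 0)

open scoped Classical in
/-- The adjoint support function: `suppStar U A = { j : ∃ i ∈ A, U j i ≠ 0 }`. -/
noncomputable def suppStar {n : ℕ} (U : Matrix (Fin n) (Fin n) ℂ) (A : Finset (Fin n)) :
    Finset (Fin n) :=
  Finset.univ.filter (fun j => ∃ i ∈ A, U j i ≠ 0)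

open scoped Classical in
/-- For a unitary `U`, there is a partition `σ_1, …, σ_p` of `{1,…,n}` whose
image family `ψ_i = supp U (σ_i)` is also a partition, with `suppStar U (ψ_i) = σ_i`,
`|σ_i| = |ψ_i|`, and every `A` with `suppStar U (supp U A) = A` is the union of
the `σ_i` contained in it. -/
theorem unitary_support_partition (n : ℕ) (U : Matrix.unitaryGroup (Fin n) ℂ) :
    ∃ (p : ℕ) (σ ψ : Fin p → Finset (Fin n)),
      (∀ i, ψ i = supp (U : Matrix (Fin n) (Fin n) ℂ) (σ i)) ∧
      (∀ i, (σ i).Nonempty) ∧ (∀ i j, i ≠ j → Disjoint (σ i) (σ j)) ∧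
      Finset.univ.biUnion σ = Finset.univ ∧
      (∀ i, (ψ i).Nonempty) ∧ (∀ i j, i ≠ j → Disjoint (ψ i) (ψ j)) ∧
      Finset.univ.biUnion ψ = Finset.univ ∧
      (∀ i, suppStar (U : Matrix (Fin n) (Fin n) ℂ) (ψ i) = σ i) ∧
      (∀ i, (σ i).card = (ψ i).card) ∧
      (∀ A : Finset (Fin n),
        suppStar (U : Matrix (Fin n) (Fin n) ℂ) (supp (U : Matrix (Fin n) (Fin n) ℂ) A) = A →
        A = (Finset.univ.filter (fun i => σ i ⊆ A)).biUnion σ) := by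
  obtain ⟨U, hU⟩ := U
  have h1 : U * star U = 1 := Matrix.mem_unitaryGroup_iff.mp hU
  have h2 : star U * U = 1 := Matrix.mem_unitaryGroup_iff'.mp hU
  have hrow : ∀ i, ∑ j, U i j * star (U i j) = 1 := by
    intro i
    have := congrFun (congrFun h1 i) i
    simpa [Matrix.mul_apply, Matrix.star_apply] using this
  have hcol : ∀ j, ∑ i, U i j * star (U i j) = 1 := by
    intro j
    have := congrFun (congrFun h2 j) j
    simpa [Matrix.mul_apply, Matrix.star_apply, mul_comm] using this
  have hrow' : ∀ i, ∃ j, U i j ≠ 0 := by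
    intro i
    by_contra! h
    have := hrow i
    simp [h] at this
  have hcol' : ∀ j, ∃ i, U i j ≠ 0 := by
    intro j
    by_contra! h
    have := hcol j
    simp [h] at this
  have ms : ∀ A j, j ∈ supp U A ↔ ∃ i ∈ A, U i j ≠ 0 := by
    intro A j; simp [supp]
  have mt : ∀ A j, j ∈ suppStar U A ↔ ∃ i ∈ A, U j i ≠ 0 := by
    intro A j; simp [suppStar]
  let R : Fin n → Fin n → Prop := fun a b => ∃ j, U a j ≠ 0 ∧ U b j ≠ 0
  let q : Fin n → Quot R := Quot.mk R
  haveI : Finite (Quot R) := Quot.finite R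
  obtain ⟨p, ⟨e⟩⟩ := Finite.exists_equiv_fin (Quot R)
  let c : Fin n → Fin p := fun i => e (q i)
  have hc : ∀ a b j, U a j ≠ 0 → U b j ≠ 0 → c a = c b := by
    intro a b j ha hb
    exact congrArg e (Quot.sound ⟨j, ha, hb⟩)
  have hcs : ∀ k, ∃ i, c i = k := by
    intro k
    obtain ⟨i, hi⟩ := Quot.exists_rep (e.symm k)
    exact ⟨i, by simp [c, q, hi]⟩
  let σ : Fin p → Finset (Fin n) := fun k => Finset.univ.filter (fun i => c i = k)
  have mσ : ∀ k i, i ∈ σ k ↔ c i = k := by intro k i; simp [σ]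
  have hst : ∀ k, suppStar U (supp U (σ k)) = σ k := by
    intro k
    ext i
    rw [mt, mσ]
    constructor
    · rintro ⟨j, hj, hij⟩
      obtain ⟨a, ha, haj⟩ := (ms _ _).1 hj
      rw [hc i a j hij haj]
      exact (mσ _ _).1 ha
    · intro hi
      obtain ⟨j, hj⟩ := hrow' i
      exact ⟨j, (ms _ _).2 ⟨i, (mσ _ _).2 hi, hj⟩, hj⟩
  refine ⟨p, σ, fun k => supp U (σ k), fun _ => rfl, ?_, ?_, ?_, ?_, ?_, ?_, hst, ?_, ?_⟩
  · intro k
    obtain ⟨i, hi⟩ := hcs k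
    exact ⟨i, (mσ _ _).2 hi⟩
  · intro k l hkl
    rw [Finset.disjoint_left]
    intro i hi hi'
    exact hkl (((mσ _ _).1 hi).symm.trans ((mσ _ _).1 hi'))
  · ext i
    simp [mσ]
  · intro k
    obtain ⟨i, hi⟩ := hcs k
    obtain ⟨j, hj⟩ := hrow' i
    exact ⟨j, (ms _ _).2 ⟨i, (mσ _ _).2 hi, hj⟩⟩
  · intro k l hkl
    rw [Finset.disjoint_left]
    intro j hj hj'
    obtain ⟨a, ha, haj⟩ := (ms _ _).1 hj
    obtain ⟨b, hb, hbj⟩ := (ms _ _).1 hj'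
    exact hkl (((mσ _ _).1 ha).symm.trans ((hc a b j haj hbj).trans ((mσ _ _).1 hb)))
  · ext j
    obtain ⟨i, hi⟩ := hcol' j
    simp only [Finset.mem_biUnion, Finset.mem_univ, true_and, iff_true]
    exact ⟨c i, (ms _ _).2 ⟨i, (mσ _ _).2 rfl, hi⟩⟩
  · intro k
    have e1 : ∀ i ∈ σ k, ∑ j ∈ supp U (σ k), U i j * star (U i j) = 1 := by
      intro i hi
      rw [← hrow i]
      apply Finset.sum_subset (Finset.subset_univ _)
      intro j _ hj
      have : U i j = 0 := by
        by_contra h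
        exact hj ((ms _ _).2 ⟨i, hi, h⟩)
      simp [this]
    have e2 : ∀ j ∈ supp U (σ k), ∑ i ∈ σ k, U i j * star (U i j) = 1 := by
      intro j hj
      rw [← hcol j]
      apply Finset.sum_subset (Finset.subset_univ _)
      intro i _ hi
      have : U i j = 0 := by
        by_contra h
        apply hi
        rw [← hst k]
        exact (mt _ _).2 ⟨j, hj, h⟩
      simp [this]
    have e3 := Finset.sum_comm (s := σ k) (t := supp U (σ k))
      (f := fun i j => U i j * star (U i j))
    rw [Finset.sum_congr rfl e1, Finset.sum_congr rfl e2] at e3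
    simpa using e3
  · intro A hA
    have hA1 : ∀ a b, R a b → a ∈ A → b ∈ A := by
      rintro a b ⟨j, ha, hb⟩ haA
      rw [← hA]
      exact (mt _ _).2 ⟨j, (ms _ _).2 ⟨a, haA, ha⟩, hb⟩
    let f : Quot R → Prop := Quot.lift (fun a => a ∈ A) (by
      intro a b hab
      exact propext ⟨hA1 a b hab, hA1 b a (by
        obtain ⟨j, x, y⟩ := hab
        exact ⟨j, y, x⟩)⟩)
    ext i
    simp only [Finset.mem_biUnion, Finset.mem_filter, Finset.mem_univ, true_and]
    constructor
    · intro hi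
      refine ⟨c i, ?_, (mσ _ _).2 rfl⟩
      intro b hb
      have hq : q b = q i := e.injective ((mσ _ _).1 hb)
      have : f (q b) = f (q i) := congrArg f hq
      exact this.mpr hi
    · rintro ⟨k, hk, hi⟩
      exact hk hi
end

section
/- Let G ⊆ ℂ^n be an open Reinhardt set with 0 ∈ G, let D ⊆ ℂ^n be open, and let F : G → D be a biholomorphism. If every biholomorphic automorphism of D fixes the origin, then F(0) = 0. -/
/-- A subset of `ℂ^n` is Reinhardt if it is invariant under independent
rotations of each coordinate. -/
def IsReinhardt (n : ℕ) (S : Set (Fin n → ℂ)) : Prop :=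
  ∀ z ∈ S, ∀ θ : Fin n → ℝ, (fun i => Complex.exp (θ i * Complex.I) * z i) ∈ S

/-- `F` is a biholomorphism from `U` onto `V`. -/
def Biholo (n : ℕ) (U V : Set (Fin n → ℂ)) (F : (Fin n → ℂ) → (Fin n → ℂ)) : Prop :=
  DifferentiableOn ℂ F U ∧ Set.MapsTo F U V ∧
    ∃ G : (Fin n → ℂ) → (Fin n → ℂ), DifferentiableOn ℂ G V ∧ Set.MapsTo G V U ∧
      (∀ z ∈ U, G (F z) = z) ∧ (∀ w ∈ V, F (G w) = w)

/-- If `G` is an open Reinhardt set containing `0`, `D` is open, `F : G → D` is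
a biholomorphism, and every biholomorphic automorphism of `D` fixes the origin,
then `F(0) = 0`. -/
theorem biholo_fixes_origin_of_target_rigid (n : ℕ) (G D : Set (Fin n → ℂ))
    (hGopen : IsOpen G) (hGRein : IsReinhardt n G) (h0 : (0 : Fin n → ℂ) ∈ G)
    (hDopen : IsOpen D) (F : (Fin n → ℂ) → (Fin n → ℂ))
    (hF : Biholo n G D F)
    (hfix : ∀ H : (Fin n → ℂ) → (Fin n → ℂ), Biholo n D D H → H 0 = 0) :
    F 0 = 0 := by
  classical
  obtain ⟨hFd, hFm, K, hKd, hKm, hKF, hFK⟩ := hF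
  have hneg : ∀ z ∈ G, -z ∈ G := by
    intro z hz
    have h := hGRein z hz (fun _ => Real.pi)
    have e : (fun i => Complex.exp (((Real.pi : ℝ) : ℂ) * Complex.I) * z i) = -z := by
      funext i
      simp [Complex.exp_pi_mul_I]
    rw [← e]
    exact h
  -- the hypothesis forces the origin to lie in `D`
  by_cases hD : (0 : Fin n → ℂ) ∈ D
  · have hH := hfix (fun w => F (-(K w))) ⟨?_, ?_, fun w => F (-(K w)), ?_, ?_, ?_, ?_⟩
    · have h1 : K (F (-(K 0))) = -(K 0) := hKF _ (hneg _ (hKm hD))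
      have h2 : K 0 = -(K 0) := (congrArg K hH).symm.trans h1
      have h3 : K 0 = 0 := self_eq_neg.mp h2
      have h4 := hFK 0 hD
      rwa [h3] at h4
    · exact hFd.comp hKd.neg (fun w hw => hneg _ (hKm hw))
    · exact fun w hw => hFm (hneg _ (hKm hw))
    · exact hFd.comp hKd.neg (fun w hw => hneg _ (hKm hw))
    · exact fun w hw => hFm (hneg _ (hKm hw))
    · intro w hw
      simp only [hKF _ (hneg _ (hKm hw)), neg_neg, hFK w hw]
    · intro w hw
      simp only [hKF _ (hneg _ (hKm hw)), neg_neg, hFK w hw]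
  · -- otherwise modify the identity at the origin, outside `D`
    have key : ∀ w ∈ D, Function.update (id : (Fin n → ℂ) → (Fin n → ℂ)) 0 (F 0) w = w := by
      intro w hw
      have : w ≠ 0 := fun h => hD (h ▸ hw)
      simp [Function.update_of_ne this]
    have hH := hfix (Function.update id 0 (F 0))
      ⟨differentiableOn_id.congr key, fun w hw => by rw [key w hw]; exact hw,
        id, differentiableOn_id, fun w hw => hw, key, key⟩
    simpa using hH
end
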